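/- arXiv:2305.14138 — 2 statements merged into one kernel-verified Lean document; each statement's English description precedes it below -/
import Mathlib

section
/- Let F be an incompressible family of pairwise commuting self-maps of a nonempty set X, and let Γ be the submonoid of X^X generated by F (which is a group of bijections). Then the automorphism group Aut(F) = {σ : X → X bijective | σ ∘ f = f ∘ σ for all f ∈ F} is exactly Γ: a bijection of X commutes with every member of F if and only if it belongs to the submonoid of X^X generated by F. -/
/-- An element commuting with a generating set commutes with the submonoid it generates. -/
theorem mul_comm_of_mem_closure {M : Type*} [Monoid M] {F : Set M} {τ σ : M}
    (hτ : ∀ f ∈ F, f * τ = τ * f) (hσ : σ ∈ Submonoid.closure F) : σ * τ = τ * σ := by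
  have hle : Submonoid.closure F ≤ Submonoid.centralizer {τ} :=
    Submonoid.closure_le.2 fun f hf => Submonoid.mem_centralizer_iff.2 fun g hg =>
      Set.mem_singleton_iff.1 hg ▸ (hτ f hf).symm
  exact (Submonoid.mem_centralizer_iff.1 (hle hσ) τ rfl).symm

/-- The elements of the closure of a pairwise commuting family commute with the family. -/
theorem commute_of_mem_closure {M : Type*} [Monoid M] {F : Set M}
    (hcomm : ∀ f ∈ F, ∀ g ∈ F, f * g = g * f) {σ : M} (hσ : σ ∈ Submonoid.closure F) :
    ∀ f ∈ F, σ * f = f * σ :=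
  fun f hf => mul_comm_of_mem_closure (fun g hg => hcomm g hg f hf) hσ

/-- Two maps commuting with an incompressible family that agree at one point are equal. -/
theorem eq_of_commute_of_apply_eq {X : Type*} {F : Set (Function.End X)}
    (hinc : ∀ I : Set X, I.Nonempty → (∀ f ∈ F, ∀ x ∈ I, f x ∈ I) → I = Set.univ)
    {σ τ : Function.End X} (hσ : ∀ f ∈ F, σ * f = f * σ) (hτ : ∀ f ∈ F, τ * f = f * τ)
    {x : X} (hx : σ x = τ x) : σ = τ := by
  have h := hinc {y | σ y = τ y} ⟨x, hx⟩ fun f hf y hy =>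
    calc σ (f y) = f (σ y) := congrFun (hσ f hf) y
      _ = f (τ y) := congrArg f hy
      _ = τ (f y) := (congrFun (hτ f hf) y).symm
  exact funext fun y => Set.eq_univ_iff_forall.1 h y

/-- The submonoid generated by an incompressible family acts transitively. -/
theorem exists_mem_closure_apply_eq {X : Type*} {F : Set (Function.End X)}
    (hinc : ∀ I : Set X, I.Nonempty → (∀ f ∈ F, ∀ x ∈ I, f x ∈ I) → I = Set.univ)
    (x y : X) : ∃ γ ∈ Submonoid.closure F, γ x = y := by
  have h := hinc {z | ∃ γ ∈ Submonoid.closure F, γ x = z} ⟨x, 1, one_mem _, rfl⟩ <| by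
    rintro f hf _ ⟨γ, hγ, rfl⟩
    exact ⟨f * γ, mul_mem (Submonoid.subset_closure hf) hγ, rfl⟩
  exact Set.eq_univ_iff_forall.1 h y

theorem stmt5 {X : Type*} [Nonempty X] (F : Set (Function.End X))
    (hinc : ∀ I : Set X, I.Nonempty → (∀ f ∈ F, ∀ x ∈ I, f x ∈ I) → I = Set.univ)
    (hcomm : ∀ f ∈ F, ∀ g ∈ F, f * g = g * f) :
    ∀ σ : Function.End X,
      (Function.Bijective σ ∧ ∀ f ∈ F, σ * f = f * σ) ↔ σ ∈ Submonoid.closure F := by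
  intro σ
  constructor
  · rintro ⟨-, hσ⟩
    obtain ⟨x⟩ := ‹Nonempty X›
    obtain ⟨γ, hγ, hx⟩ := exists_mem_closure_apply_eq hinc x (σ x)
    rwa [← eq_of_commute_of_apply_eq hinc (commute_of_mem_closure hcomm hγ) hσ hx]
  · intro hmem
    have hσ := commute_of_mem_closure hcomm hmem
    refine ⟨⟨fun a b hab => ?_, Set.range_eq_univ.1 ?_⟩, hσ⟩
    · obtain ⟨γ, hγ, rfl⟩ := exists_mem_closure_apply_eq hinc a b
      have hγF := commute_of_mem_closure hcomm hγ
      have hγσ : γ * σ = σ * γ :=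
        mul_comm_of_mem_closure (fun f hf => (hσ f hf).symm) hγ
      have hfix : γ (σ a) = σ a := (congrFun hγσ a).trans hab.symm
      have h : γ = 1 := eq_of_commute_of_apply_eq hinc hγF
        (fun f _ => by rw [one_mul, mul_one]) hfix
      rw [h]
      rfl
    · refine hinc _ (Set.range_nonempty σ) ?_
      rintro f hf _ ⟨y, rfl⟩
      exact ⟨f y, congrFun (hσ f hf) y⟩
end

section
/- Let X be a nonempty set and f, g : X → X commuting self-maps. The pair {f, g} is incompressible if and only if there exist integers m ≥ 0, n ≥ 1, d ≥ 1 with d ≤ m whenever m > 0, and a bijection φ : X → (ℤ/mℤ) × (ℤ/nℤ) (with ℤ/0ℤ = ℤ when m = 0) such that φ conjugates f to translation by (1,0) and conjugates g to the odometer map sending (a,b) to (a, b+1) if 0 ≤ b < n−1 and to (a−d, 0) if b = n−1. Equivalently, the Lyubashenko YB-solution R(x,y) = (f(x), g(y)) is simple exactly when such a triple (m,n,d) and bijection φ exist. -/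
/-- A nonempty subset `I ⊆ X` is an ideal of `R : X × X → X × X` if
`R(I × X) ⊆ I × X` and `R(X × I) ⊆ X × I`. -/
def IsIdeal {X : Type*} (R : X × X → X × X) (I : Set X) : Prop :=
  I.Nonempty ∧ (∀ x ∈ I, ∀ y : X, (R (x, y)).1 ∈ I) ∧ (∀ x : X, ∀ y ∈ I, (R (x, y)).2 ∈ I)

/-- `R` is simple if its only ideal is `X` itself. -/
def IsSimple {X : Type*} (R : X × X → X × X) : Prop :=
  ∀ I : Set X, IsIdeal R I → I = Set.univ

/-- There exist `m ≥ 0`, `n ≥ 1`, `d ≥ 1` with `d ≤ m` whenever `m > 0`, and a bijection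
`φ : X ≃ ℤ/m × ℤ/n` (with `ℤ/0 = ℤ`) conjugating `f` to translation by `(1,0)` and `g`
to the odometer map. -/
def OdometerForm {X : Type*} (f g : X → X) : Prop :=
  ∃ m n d : ℕ, 1 ≤ n ∧ 1 ≤ d ∧ (0 < m → d ≤ m) ∧
    ∃ φ : X ≃ ZMod m × ZMod n,
      (∀ x : X, φ (f x) = ((φ x).1 + 1, (φ x).2)) ∧
      (∀ x : X, φ (g x) =
        if (φ x).2.val = n - 1 then ((φ x).1 - (d : ZMod m), 0)
        else ((φ x).1, (φ x).2 + 1))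

/-- The pair `f, g` is incompressible: no proper nonempty subset is stable under both maps. -/
def IsIncompressiblePair {X : Type*} (f g : X → X) : Prop :=
  ∀ I : Set X, I.Nonempty → (∀ x ∈ I, f x ∈ I) → (∀ x ∈ I, g x ∈ I) → I = Set.univ

theorem IsIncompressiblePair.symm {X : Type*} {f g : X → X} (h : IsIncompressiblePair f g) :
    IsIncompressiblePair g f :=
  fun I hI hg hf => h I hI hf hg

theorem isSimple_prodMap_iff {X : Type*} [Nonempty X] (f g : X → X) :
    IsSimple (fun p : X × X => (f p.1, g p.2)) ↔ IsIncompressiblePair f g := by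
  refine ⟨fun h I hI hf hg => h I ⟨hI, fun x hx _ => hf x hx, fun _ y hy => hg y hy⟩, ?_⟩
  rintro h I ⟨hI, hf, hg⟩
  exact h I hI (fun x hx => hf x hx x) (fun x hx => hg x x hx)

theorem IsIncompressiblePair.exists_iterate_eq {X : Type*} {f g : X → X}
    (h : IsIncompressiblePair f g) (hfg : Function.Commute f g) (x y : X) :
    ∃ a b : ℕ, f^[a] (g^[b] x) = y := by
  have key : {y | ∃ a b : ℕ, f^[a] (g^[b] x) = y} = Set.univ := by
    refine h _ ⟨x, 0, 0, rfl⟩ ?_ ?_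
    · rintro _ ⟨a, b, rfl⟩
      exact ⟨a + 1, b, Function.iterate_succ_apply' f a _⟩
    · rintro _ ⟨a, b, rfl⟩
      refine ⟨a, b + 1, ?_⟩
      rw [Function.iterate_succ_apply']
      exact (hfg.iterate_left a) _
  exact Set.eq_univ_iff_forall.1 key y

/-- A self-map commuting with an incompressible pair and having a fixed point is the identity. -/
theorem IsIncompressiblePair.apply_eq_of_commute {X : Type*} {f g w : X → X}
    (h : IsIncompressiblePair f g) (hf : Function.Commute w f) (hg : Function.Commute w g)
    {x : X} (hx : w x = x) (y : X) : w y = y := by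
  have key : {y | w y = y} = Set.univ := by
    refine h _ ⟨x, hx⟩ ?_ ?_
    · intro z hz
      exact (hf z).trans (congrArg f hz)
    · intro z hz
      exact (hg z).trans (congrArg g hz)
  exact Set.eq_univ_iff_forall.1 key y

theorem IsIncompressiblePair.exists_leftInverse {X : Type*} [Nonempty X] {f g : X → X}
    (h : IsIncompressiblePair f g) (hfg : Function.Commute f g) :
    ∃ a b : ℕ, ∀ y, f^[a] (g^[b] (f y)) = y := by
  obtain ⟨x⟩ := ‹Nonempty X›
  obtain ⟨a, b, hab⟩ := h.exists_iterate_eq hfg (f x) x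
  have hf : Function.Commute (f^[a] ∘ g^[b] ∘ f) f :=
    ((Function.Commute.refl f).iterate_left a).comp_left
      ((hfg.symm.iterate_left b).comp_left (Function.Commute.refl f))
  have hg : Function.Commute (f^[a] ∘ g^[b] ∘ f) g :=
    (hfg.iterate_left a).comp_left
      (((Function.Commute.refl g).iterate_left b).comp_left hfg)
  exact ⟨a, b, h.apply_eq_of_commute hf hg hab⟩

theorem IsIncompressiblePair.bijective {X : Type*} [Nonempty X] {f g : X → X}
    (h : IsIncompressiblePair f g) (hfg : Function.Commute f g) : Function.Bijective f := by
  obtain ⟨a, b, hab⟩ := h.exists_leftInverse hfg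
  refine ⟨Function.LeftInverse.injective (g := f^[a] ∘ g^[b]) hab, fun y => ?_⟩
  refine ⟨f^[a] (g^[b] y), ?_⟩
  have hf : Function.Commute (f^[a] ∘ g^[b]) f :=
    ((Function.Commute.refl f).iterate_left a).comp_left (hfg.symm.iterate_left b)
  exact (hf y).symm.trans (hab y)

theorem zpow_eq_zpow_iff_intCast_zmod {G : Type*} [Group G] (x : G) (i j : ℤ) :
    x ^ i = x ^ j ↔ (i : ZMod (orderOf x)) = (j : ZMod (orderOf x)) := by
  rw [zpow_eq_zpow_iff_modEq, ZMod.intCast_eq_intCast_iff]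

theorem ZMod.exists_natCast_eq_of_pos {m : ℕ} (hm : 0 < m) (c : ZMod m) :
    ∃ d : ℕ, 1 ≤ d ∧ d ≤ m ∧ (d : ZMod m) = c := by
  have : NeZero m := ⟨hm.ne'⟩
  exact ⟨(c - 1).val + 1, by omega, ZMod.val_lt _, by simp⟩

/-- Data describing the relations between two elements of a group, when some
product of positive powers of them is trivial. -/
theorem exists_odometer_relation {G : Type*} [Group G] {x y : G}
    {A B : ℕ} (hA : 0 < A) (hB : 0 < B) (hAB : x ^ A * y ^ B = 1) :
    ∃ n d : ℕ, 1 ≤ n ∧ 1 ≤ d ∧ (0 < orderOf x → d ≤ orderOf x) ∧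
      y ^ n = x ^ (-(d : ℤ)) ∧ ∀ k : ℕ, y ^ k ∈ Subgroup.zpowers x → n ∣ k := by
  classical
  have hBx : y ^ B = x ^ (-(A : ℤ)) := by
    rw [zpow_neg, zpow_natCast]
    exact (inv_eq_of_mul_eq_one_right hAB).symm
  have hex : ∃ n : ℕ, 0 < n ∧ y ^ n ∈ Subgroup.zpowers x :=
    ⟨B, hB, hBx ▸ ⟨_, rfl⟩⟩
  obtain ⟨hn, hmem⟩ := Nat.find_spec hex
  have hmin : ∀ k : ℕ, 0 < k → y ^ k ∈ Subgroup.zpowers x → Nat.find hex ≤ k :=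
    fun k hk h => Nat.find_min' hex ⟨hk, h⟩
  generalize Nat.find hex = n at hn hmem hmin
  have hdvd : ∀ k : ℕ, y ^ k ∈ Subgroup.zpowers x → n ∣ k := by
    intro k hk
    refine Nat.dvd_of_mod_eq_zero (Nat.eq_zero_of_not_pos fun hpos => ?_)
    refine (Nat.mod_lt k hn).not_ge (hmin _ hpos ?_)
    rw [← Nat.mod_add_div k n, pow_add, pow_mul] at hk
    exact (Subgroup.mul_mem_cancel_right _ (Subgroup.pow_mem _ hmem _)).1 hk
  obtain ⟨e, he⟩ := hmem
  replace he : x ^ e = y ^ n := he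
  rcases Nat.eq_zero_or_pos (orderOf x) with hm | hm
  · obtain ⟨k, rfl⟩ := hdvd B (hBx ▸ ⟨_, rfl⟩)
    have hk : (0 : ℤ) < k := by
      exact_mod_cast Nat.pos_of_mul_pos_left hB
    have hek : e * k = -(A : ℤ) := by
      rw [pow_mul, ← he, ← zpow_natCast, ← zpow_mul] at hBx
      have := (zpow_eq_zpow_iff_modEq).1 hBx
      simpa [hm, Int.ModEq] using this
    have he0 : e < 0 := by
      by_contra! hcon
      have : 0 ≤ e * (k : ℤ) := Int.mul_nonneg hcon hk.le
      omega
    refine ⟨n, e.natAbs, hn, by omega, by omega, ?_, hdvd⟩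
    rw [← he]
    congr 1
    omega
  · obtain ⟨d, hd1, hdm, hd⟩ := ZMod.exists_natCast_eq_of_pos hm ((-e : ℤ) : ZMod (orderOf x))
    refine ⟨n, d, hn, hd1, fun _ => hdm, ?_, hdvd⟩
    rw [← he, zpow_eq_zpow_iff_intCast_zmod]
    push_cast
    rw [hd]
    push_cast
    ring

theorem ZMod.val_add_one_of_val_ne {n : ℕ} (hn : 1 ≤ n) {b : ZMod n} (hb : b.val ≠ n - 1) :
    (b + 1).val = b.val + 1 := by
  have : NeZero n := ⟨by omega⟩
  have := ZMod.val_lt b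
  have h1 : Fact (1 < n) := ⟨by omega⟩
  rw [ZMod.val_add_of_lt, ZMod.val_one]
  rw [ZMod.val_one]
  omega

theorem IsIncompressiblePair.odometerForm {X : Type*} [Nonempty X] {f g : X → X}
    (h : IsIncompressiblePair f g) (hfg : Function.Commute f g) : OdometerForm f g := by
  obtain ⟨F, rfl⟩ : ∃ F : Equiv.Perm X, ⇑F = f := ⟨Equiv.ofBijective f (h.bijective hfg), rfl⟩
  obtain ⟨G, rfl⟩ : ∃ G : Equiv.Perm X, ⇑G = g :=
    ⟨Equiv.ofBijective g (h.symm.bijective hfg.symm), rfl⟩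
  have hFG : Commute F G := Equiv.ext hfg
  obtain ⟨a, b, hab⟩ := h.exists_leftInverse hfg
  obtain ⟨b', a', hab'⟩ := h.symm.exists_leftInverse hfg.symm
  have h1 : F ^ a * G ^ b * F = 1 := Equiv.ext fun y => by
    have := hab y
    rwa [Equiv.Perm.iterate_eq_pow, Equiv.Perm.iterate_eq_pow] at this
  have h2 : G ^ b' * F ^ a' * G = 1 := Equiv.ext fun y => by
    have := hab' y
    rwa [Equiv.Perm.iterate_eq_pow, Equiv.Perm.iterate_eq_pow] at this
  have h3 : F ^ (a + 1 + a') * G ^ (b' + 1 + b) = 1 := by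
    have e1 : F ^ (a + 1) * G ^ b = 1 := by
      rw [pow_succ, mul_assoc, (hFG.pow_right b).eq, ← mul_assoc, h1]
    have e2 : F ^ a' * G ^ (b' + 1) = 1 := by
      rw [pow_succ, ← mul_assoc, (hFG.pow_pow a' b').eq, h2]
    rw [pow_add F, pow_add G, mul_assoc, ← mul_assoc (F ^ a'), e2, one_mul, e1]
  obtain ⟨n, d, hn, hd, hdm, hGn, hdvd⟩ :=
    exists_odometer_relation (by omega) (by omega) h3
  have : NeZero n := ⟨by omega⟩
  obtain ⟨x⟩ := ‹Nonempty X›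
  have hfree : ∀ w : Equiv.Perm X, Commute w F → Commute w G → w x = x → w = 1 :=
    fun w hF hG hx => Equiv.ext fun y =>
      h.apply_eq_of_commute (w := w) (fun z => DFunLike.congr_fun hF z)
        (fun z => DFunLike.congr_fun hG z) hx y
  have hinj : ∀ (i j : ℤ) (k l : ℕ), (F ^ i * G ^ k) x = (F ^ j * G ^ l) x →
      F ^ i * G ^ k = F ^ j * G ^ l := by
    intro i j k l hx
    have cF : ∀ (i : ℤ) (k : ℕ), Commute (F ^ i * G ^ k) F := fun i k =>
      ((Commute.refl F).zpow_left i).mul_left (hFG.symm.pow_left k)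
    have cG : ∀ (i : ℤ) (k : ℕ), Commute (F ^ i * G ^ k) G := fun i k =>
      (hFG.zpow_left i).mul_left ((Commute.refl G).pow_left k)
    refine (inv_mul_eq_one.1 (hfree _ ((cF j l).inv_left.mul_left (cF i k))
      ((cG j l).inv_left.mul_left (cG i k)) ?_)).symm
    rw [Equiv.Perm.mul_apply, hx]
    exact Equiv.symm_apply_apply _ _
  let m := orderOf F
  have hcast : ∀ (i : ℤ), F ^ ((i : ZMod m).cast : ℤ) = F ^ i := fun i =>
    (zpow_eq_zpow_iff_intCast_zmod F _ _).2 (ZMod.intCast_zmod_cast _)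
  have hcast' : ∀ (c : ZMod m) (i : ℤ), F ^ ((c + (i : ZMod m)).cast : ℤ) = F ^ (c.cast + i : ℤ) :=
    fun c i => by
      rw [← hcast (c.cast + i), Int.cast_add, ZMod.intCast_zmod_cast]
  let θ : ZMod m × ZMod n → X := fun p => (F ^ (p.1.cast : ℤ) * G ^ p.2.val) x
  have hFθ : ∀ p, F (θ p) = θ (p.1 + 1, p.2) := by
    intro p
    have := hcast' p.1 1
    rw [Int.cast_one] at this
    simp only [θ]
    rw [this, add_comm, zpow_add, zpow_one, mul_assoc]
    rfl
  have hGθ : ∀ p, G (θ p) = θ (if p.2.val = n - 1 then (p.1 - (d : ZMod m), 0)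
      else (p.1, p.2 + 1)) := by
    intro p
    have hGp : G (θ p) = (F ^ (p.1.cast : ℤ) * G ^ (p.2.val + 1)) x := by
      rw [pow_succ', ← mul_assoc, (hFG.zpow_left _).eq, mul_assoc]
      rfl
    rw [hGp]
    split_ifs with hp
    · have := hcast' p.1 (-(d : ℤ))
      rw [Int.cast_neg, Int.cast_natCast, ← sub_eq_add_neg] at this
      simp only [θ]
      rw [this, hp, Nat.sub_add_cancel hn, hGn, ZMod.val_zero, pow_zero, mul_one, zpow_add]
    · simp only [θ]
      rw [ZMod.val_add_one_of_val_ne hn hp]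
  have hθinj : Function.Injective θ := by
    rintro ⟨c, k⟩ ⟨c', k'⟩ hθ
    have hE : F ^ (c.cast : ℤ) * G ^ k.val = F ^ (c'.cast : ℤ) * G ^ k'.val := hinj _ _ _ _ hθ
    have aux : ∀ (i j : ℤ) (k l : ℕ), k ≤ l → l < n →
        F ^ i * G ^ k = F ^ j * G ^ l → k = l := by
      intro i j k l hkl hl hE
      obtain ⟨r, rfl⟩ := Nat.exists_eq_add_of_le hkl
      rw [add_comm, pow_add, ← mul_assoc, mul_left_inj] at hE
      have hr : n ∣ r := hdvd r ⟨-j + i, by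
        change F ^ (-j + i) = _
        rw [zpow_add, hE, zpow_neg, inv_mul_cancel_left]⟩
      have := Nat.eq_zero_of_dvd_of_lt hr (by omega)
      omega
    have hk : k.val = k'.val := by
      rcases le_total k.val k'.val with hle | hle
      · exact aux _ _ _ _ hle (ZMod.val_lt _) hE
      · exact (aux _ _ _ _ hle (ZMod.val_lt _) hE.symm).symm
    rw [hk, mul_left_inj, zpow_eq_zpow_iff_intCast_zmod] at hE
    refine Prod.ext ?_ (ZMod.val_injective n hk)
    rwa [ZMod.intCast_zmod_cast, ZMod.intCast_zmod_cast] at hE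
  have hθsurj : Function.Surjective θ := by
    refine Set.range_eq_univ.1 (h _ ⟨θ 0, 0, rfl⟩ ?_ ?_)
    · rintro _ ⟨p, rfl⟩
      exact ⟨_, (hFθ p).symm⟩
    · rintro _ ⟨p, rfl⟩
      exact ⟨_, (hGθ p).symm⟩
  let φ := (Equiv.ofBijective θ ⟨hθinj, hθsurj⟩).symm
  have hφ : ∀ y, θ (φ y) = y := (Equiv.ofBijective θ ⟨hθinj, hθsurj⟩).apply_symm_apply
  refine ⟨m, n, d, hn, hd, hdm, φ, fun y => hθinj ?_, fun y => hθinj ?_⟩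
  · rw [hφ, ← hFθ, hφ]
  · rw [hφ, ← hGθ, hφ]

theorem OdometerForm.isIncompressiblePair {X : Type*} {f g : X → X} (h : OdometerForm f g) :
    IsIncompressiblePair f g := by
  obtain ⟨m, n, d, hn, hd, -, φ, hf, hg⟩ := h
  rintro I ⟨x, hx⟩ hfI hgI
  have : NeZero n := ⟨by omega⟩
  let J : Set (ZMod m × ZMod n) := {p | φ.symm p ∈ I}
  have hmem : ∀ y, φ y ∈ J ↔ y ∈ I := fun y => by simp [J]
  have hfJ : ∀ a b, (a, b) ∈ J → (a + 1, b) ∈ J := by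
    intro a b hab
    have := (hmem _).2 (hfI _ hab)
    simpa [hf] using this
  have hgJ : ∀ a b, (a, b) ∈ J →
      (if b.val = n - 1 then (a - (d : ZMod m), 0) else (a, b + 1)) ∈ J := by
    intro a b hab
    have := (hmem _).2 (hgI _ hab)
    simpa [hg] using this
  have hup : ∀ a (k l : ℕ), k ≤ l → l < n → (a, (k : ZMod n)) ∈ J → (a, (l : ZMod n)) ∈ J := by
    intro a k l hkl
    induction l, hkl using Nat.le_induction with
    | base => exact fun _ h => h
    | succ l _ ih =>
      intro hl h
      have := hgJ _ _ (ih (by omega) h)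
      rw [ZMod.val_natCast_of_lt (by omega), if_neg (by omega)] at this
      simpa using this
  have hadd : ∀ (k : ℕ) a b, (a, b) ∈ J → (a + k, b) ∈ J := by
    intro k a b hab
    induction k with
    | zero => simpa using hab
    | succ k ih => simpa [add_assoc] using hfJ _ _ ih
  have hsub : ∀ a b c, (a, b) ∈ J → (a - 1, c) ∈ J := by
    intro a b c hab
    have h1 : (a, ((n - 1 : ℕ) : ZMod n)) ∈ J := by
      refine hup a b.val _ ?_ (by omega) (by simpa using hab)
      have := ZMod.val_lt b
      omega
    have h2 := hgJ _ _ h1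
    rw [ZMod.val_natCast_of_lt (by omega), if_pos rfl] at h2
    have h3 := hup _ 0 c.val (Nat.zero_le _) (ZMod.val_lt c) (by simpa using h2)
    have h4 := hadd (d - 1) _ _ h3
    rw [Nat.cast_sub hd] at h4
    simpa using h4
  have hdown : ∀ (k : ℕ) a b c, (a, b) ∈ J → (a - (k + 1 : ℕ), c) ∈ J := by
    intro k a b c hab
    induction k generalizing c with
    | zero => simpa using hsub a b c hab
    | succ k ih =>
      have := hsub _ _ c (ih c)
      rwa [sub_sub, ← Nat.cast_succ] at this
  have hall : ∀ p, p ∈ J := by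
    rintro ⟨a, c⟩
    have hx' : ((φ x).1, (φ x).2) ∈ J := (hmem x).2 hx
    obtain ⟨i, hi⟩ := ZMod.intCast_surjective (a - ((φ x).1 - 1))
    have h1 : ∀ k : ℕ, ((φ x).1 - 1 + k, c) ∈ J := fun k => hadd k _ _ (hsub _ _ c hx')
    have h2 : ∀ k : ℕ, ((φ x).1 - 1 - (k + 1 : ℕ), c) ∈ J := fun k =>
      hdown k _ _ c (hsub _ _ c hx')
    have ha : a = (φ x).1 - 1 + i := by rw [hi]; ring
    rw [ha]
    rcases i with k | k
    · simpa using h1 k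
    · simpa [Int.cast_negSucc, sub_eq_add_neg] using h2 k
  exact Set.eq_univ_of_forall fun y => (hmem y).1 (hall _)

theorem stmt7 {X : Type*} [Nonempty X] (f g : X → X) (hfg : f ∘ g = g ∘ f) :
    ((∀ I : Set X, I.Nonempty → (∀ x ∈ I, f x ∈ I) → (∀ x ∈ I, g x ∈ I) → I = Set.univ) ↔
      OdometerForm f g) ∧
    (IsSimple (fun p : X × X => (f p.1, g p.2)) ↔ OdometerForm f g) := by
  have key : IsIncompressiblePair f g ↔ OdometerForm f g :=
    ⟨fun h => h.odometerForm (congrFun hfg), OdometerForm.isIncompressiblePair⟩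
  exact ⟨key, (isSimple_prodMap_iff f g).trans key⟩
end
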